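/- arXiv:2111.12601 — 2 statements merged into one kernel-verified Lean document; each statement's English description precedes it below -/
import Mathlib

section
/- Let H be a complex Hilbert space and let H, K be positive bounded operators on it with H invertible. Then there exists at most one positive bounded operator X such that XHX = K, and such an X exists; moreover it is given by X = H^{-1/2}(H^{1/2}KH^{1/2})^{1/2}H^{-1/2}. -/
/-- Pedersen–Takesaki: for positive `H K` on a complex Hilbert space with `H` invertible,
there is exactly one positive `X` with `XHX = K`, and it is given by
`X = H^{-1/2} (H^{1/2} K H^{1/2})^{1/2} H^{-1/2}`. -/
theorem stmt_0 {𝓗 : Type*} [NormedAddCommGroup 𝓗] [InnerProductSpace ℂ 𝓗] [CompleteSpace 𝓗]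
    (H K : 𝓗 →L[ℂ] 𝓗) (hH : 0 ≤ H) (hK : 0 ≤ K) (hHinv : IsUnit H) :
    (∃! X : 𝓗 →L[ℂ] 𝓗, 0 ≤ X ∧ X * H * X = K) ∧
    ∀ X : 𝓗 →L[ℂ] 𝓗, 0 ≤ X → X * H * X = K →
      X = Ring.inverse (CFC.sqrt H) * CFC.sqrt (CFC.sqrt H * K * CFC.sqrt H) *
        Ring.inverse (CFC.sqrt H) := by
  set S := CFC.sqrt H with hS
  set T := CFC.sqrt (S * K * S) with hT
  set R := Ring.inverse S with hR
  have hS0 : 0 ≤ S := CFC.sqrt_nonneg H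
  have hSS : S * S = H := CFC.sqrt_mul_sqrt_self H hH
  have hSu : IsUnit S := (CFC.isUnit_sqrt_iff H hH).mpr hHinv
  have hSR : S * R = 1 := Ring.mul_inverse_cancel S hSu
  have hRS : R * S = 1 := Ring.inverse_mul_cancel S hSu
  have hR0 : 0 ≤ R := (CFC.ringInverse_nonneg_iff_nonneg_of_isUnit hSu).mpr hS0
  have hTT : T * T = S * K * S :=
    CFC.sqrt_mul_sqrt_self _ (conjugate_nonneg_of_nonneg hK hS0)
  have formula : ∀ X : 𝓗 →L[ℂ] 𝓗, 0 ≤ X → X * H * X = K → X = R * T * R := by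
    intro X hX hXK
    have hTX : T = S * X * S := by
      refine CFC.sqrt_unique ?_ (conjugate_nonneg_of_nonneg hX hS0)
      rw [← hXK, ← hSS]
      simp only [mul_assoc]
    calc X = (R * S) * X * (S * R) := by rw [hRS, hSR, one_mul, mul_one]
      _ = R * T * R := by rw [hTX]; simp only [mul_assoc]
  refine ⟨⟨R * T * R, ⟨conjugate_nonneg_of_nonneg (CFC.sqrt_nonneg _) hR0, ?_⟩,
    fun X hX => formula X hX.1 hX.2⟩, formula⟩
  calc R * T * R * H * (R * T * R) = R * T * (R * S) * (S * R) * T * R := by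
        rw [← hSS]; simp only [mul_assoc]
    _ = R * (T * T) * R := by rw [hRS, hSR]; simp only [mul_one, mul_assoc]
    _ = (R * S) * K * (S * R) := by rw [hTT]; simp only [mul_assoc]
    _ = K := by rw [hRS, hSR, one_mul, mul_one]
end

section
/- Let E = l²(A) for a C*-algebra A and let A, B be adjointable operators on E with BB* ≤ λ AA* for some λ > 0. Then for every pure state f on A, range(B) ⊆ range(A) + N_{E,f}, where N_{E,f} = {x ∈ E : f(⟨x,x⟩) = 0}. -/
open scoped ComplexOrder

variable (A : Type*) [NonUnitalCStarAlgebra A] [PartialOrder A] [StarOrderedRing A]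

/-- The standard Hilbert `A`-module `l²(A)`: sequences `(aᵢ)` in `A` such that
`Σ aᵢ* aᵢ` is norm-convergent. -/
def l2 : Type _ := {x : ℕ → A // Summable fun n => star (x n) * x n}

variable {A}

/-- The `A`-valued inner product on `l²(A)`: `⟪x, y⟫ = Σ xᵢ* yᵢ`. -/
noncomputable def l2Inner (x y : l2 A) : A := ∑' n, star (x.1 n) * y.1 n

section Representation

open Filter Topology InnerProductSpace

variable {B : Type*} [NonUnitalCStarAlgebra B]
  {H : Type*} [NormedAddCommGroup H] [InnerProductSpace ℂ H] [CompleteSpace H]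

theorem inner_rep_left (π : B →⋆ₙₐ[ℂ] (H →L[ℂ] H)) (a : B) (x y : H) :
    ⟪π a x, y⟫_ℂ = ⟪x, π (star a) y⟫_ℂ := by
  rw [map_star, ContinuousLinearMap.star_eq_adjoint, ContinuousLinearMap.adjoint_inner_right]

theorem rep_mul_apply (π : B →⋆ₙₐ[ℂ] (H →L[ℂ] H)) (a b : B) (x : H) :
    π (a * b) x = π a (π b x) := by
  rw [map_mul]; rfl

theorem inner_rep_right (π : B →⋆ₙₐ[ℂ] (H →L[ℂ] H)) (a : B) (x y : H) :
    ⟪x, π a y⟫_ℂ = ⟪π (star a) x, y⟫_ℂ := by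
  rw [inner_rep_left, star_star]

/-- A representation is irreducible if every self-adjoint operator in its commutant is scalar. -/
def IrreducibleRep (π : B →⋆ₙₐ[ℂ] (H →L[ℂ] H)) : Prop :=
  ∀ W : H →L[ℂ] H, IsSelfAdjoint W → (∀ a x, W (π a x) = π a (W x)) → ∃ c : ℂ, ∀ x, W x = c • x

theorem eq_zero_of_rep_eq_zero (π : B →⋆ₙₐ[ℂ] (H →L[ℂ] H)) {ξ : H}
    (hξ : DenseRange fun a => π a ξ) {z : H} (hz : ∀ a, π a z = 0) : z = 0 := by
  refine hξ.eq_zero_of_inner_right ℂ fun a => ?_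
  rw [inner_rep_left, hz, inner_zero_right]

theorem eq_zero_of_inner_rep_self_eq_zero (π : B →⋆ₙₐ[ℂ] (H →L[ℂ] H)) {ξ : H}
    (hξ : DenseRange fun a => π a ξ) {z : H} (hz : ∀ a, ⟪z, π a z⟫_ℂ = 0) : z = 0 := by
  refine eq_zero_of_rep_eq_zero π hξ fun a => ?_
  rw [← inner_self_eq_zero (𝕜 := ℂ), inner_rep_left, ← rep_mul_apply, hz]

theorem IrreducibleRep.exists_scalar {π : B →⋆ₙₐ[ℂ] (H →L[ℂ] H)} (hπ : IrreducibleRep π)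
    (V : H →L[ℂ] H) (hV : ∀ a x, V (π a x) = π a (V x)) : ∃ c : ℂ, ∀ x, V x = c • x := by
  have hV' : ∀ a x, (star V) (π a x) = π a ((star V) x) := by
    intro a x
    refine ext_inner_right ℂ fun y => ?_
    rw [ContinuousLinearMap.star_eq_adjoint, ContinuousLinearMap.adjoint_inner_left,
      inner_rep_left, inner_rep_left, ContinuousLinearMap.adjoint_inner_left, hV]
  obtain ⟨c, hc⟩ := hπ (V + star V) (IsSelfAdjoint.add_star_self V) (by
    intro a x
    simp [hV, hV'])
  obtain ⟨d, hd⟩ := hπ (Complex.I • (V - star V)) (by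
    rw [isSelfAdjoint_iff, star_smul, star_sub, star_star, Complex.star_def, Complex.conj_I,
      neg_smul, ← smul_neg, neg_sub]) (by
    intro a x
    simp [hV, hV'])
  refine ⟨(c - Complex.I * d) / 2, fun x => ?_⟩
  have h1 := hc x
  have h2 := hd x
  simp only [add_apply, smul_apply,
    sub_apply] at h1 h2
  have h3 : (c - Complex.I * d) • x = (2 : ℂ) • V x := by
    rw [sub_smul, mul_smul, ← h1, ← h2, smul_smul, Complex.I_mul_I]
    module
  rw [div_eq_inv_mul, mul_smul, h3, smul_smul]
  simp

/-- The orbit map `a ↦ π a p`. -/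
noncomputable def orbitMap (π : B →⋆ₙₐ[ℂ] (H →L[ℂ] H)) (p : H) : B →ₗ[ℂ] H where
  toFun a := π a p
  map_add' a b := by simp
  map_smul' c a := by simp

@[simp]
theorem orbitMap_apply (π : B →⋆ₙₐ[ℂ] (H →L[ℂ] H)) (p : H) (a : B) : orbitMap π p a = π a p := rfl

theorem IrreducibleRep.denseRange_orbitMap {π : B →⋆ₙₐ[ℂ] (H →L[ℂ] H)} (hπ : IrreducibleRep π)
    {ξ : H} (hξ : DenseRange fun a => π a ξ) {p : H} (hp : p ≠ 0) :
    DenseRange (orbitMap π p) := by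
  set K := (LinearMap.range (orbitMap π p)).topologicalClosure with hK
  have hKc : IsClosed (K : Set H) := Submodule.isClosed_topologicalClosure _
  have : CompleteSpace K := hKc.completeSpace_coe
  have hmem : ∀ a, π a p ∈ K := fun a =>
    Submodule.le_topologicalClosure _ (LinearMap.mem_range_self (orbitMap π p) a)
  have hinv : ∀ a, ∀ x ∈ K, π a x ∈ K := by
    intro a x hx
    have hx' : x ∈ closure (LinearMap.range (orbitMap π p) : Set H) := hx
    refine map_mem_closure (π a).continuous hx' ?_
    rintro _ ⟨b, rfl⟩
    exact ⟨a * b, by simp⟩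
  have hinv' : ∀ a, ∀ x ∈ Kᗮ, π a x ∈ Kᗮ := by
    intro a x hx
    rw [Submodule.mem_orthogonal] at hx ⊢
    intro u hu
    rw [inner_rep_right]
    exact hx _ (hinv _ _ hu)
  have hcomm : ∀ a x, K.starProjection (π a x) = π a (K.starProjection x) := by
    intro a x
    refine (Submodule.eq_starProjection_of_mem_of_inner_eq_zero
      (hinv _ _ (K.starProjection_apply_mem x)) fun w hw => ?_)
    rw [← map_sub]
    have := hinv' a _ (K.sub_starProjection_mem_orthogonal x)
    exact (Submodule.mem_orthogonal' _ _).1 this w hw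
  obtain ⟨c, hc⟩ := hπ K.starProjection (isSelfAdjoint_starProjection K) hcomm
  obtain ⟨a, ha⟩ : ∃ a, π a p ≠ 0 := by
    by_contra! h
    exact hp (eq_zero_of_rep_eq_zero π hξ h)
  have hc1 : c = 1 := by
    have h1 := hc (π a p)
    rw [Submodule.starProjection_eq_self_iff.2 (hmem a)] at h1
    have h2 : (1 - c) • π a p = 0 := by rw [sub_smul, one_smul, ← h1, sub_self]
    rcases smul_eq_zero.1 h2 with h | h
    · exact (sub_eq_zero.1 h).symm
    · exact absurd h ha
  intro x
  have h3 := hc x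
  rw [hc1, one_smul] at h3
  have h4 : x ∈ K := h3 ▸ K.starProjection_apply_mem x
  simpa [hK] using! h4

/-- Two vectors with the same vector functional in an irreducible representation are
proportional. -/
theorem IrreducibleRep.eq_smul_of_inner_eq {π : B →⋆ₙₐ[ℂ] (H →L[ℂ] H)} (hπ : IrreducibleRep π)
    {ξ : H} (hξ : DenseRange fun a => π a ξ) {p q : H} (hp : p ≠ 0)
    (hpq : ∀ a, ⟪p, π a p⟫_ℂ = ⟪q, π a q⟫_ℂ) : ∃ c : ℂ, q = c • p := by
  have hd := hπ.denseRange_orbitMap hξ hp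
  have hnorm : ∀ a, ‖orbitMap π q a‖ ≤ 1 * ‖orbitMap π p a‖ := by
    intro a
    have h : ⟪π a q, π a q⟫_ℂ = ⟪π a p, π a p⟫_ℂ := by
      simp only [inner_rep_left, ← rep_mul_apply, hpq]
    rw [inner_self_eq_norm_sq_to_K, inner_self_eq_norm_sq_to_K] at h
    have h' : ‖π a q‖ ^ 2 = ‖π a p‖ ^ 2 := by exact_mod_cast h
    rw [one_mul]
    exact ((sq_eq_sq₀ (norm_nonneg _) (norm_nonneg _)).1 h').le
  set V := (orbitMap π q).extendOfNorm (orbitMap π p) with hVdef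
  have hV : ∀ a, V (π a p) = π a q := fun a => LinearMap.extendOfNorm_eq hd ⟨1, hnorm⟩ a
  obtain ⟨c, hc⟩ := hπ.exists_scalar V (by
    intro a x
    refine hd.induction_on (p := fun x => V (π a x) = π a (V x)) x
      (isClosed_eq (by fun_prop) (by fun_prop)) fun b => ?_
    rw [orbitMap_apply, hV, ← rep_mul_apply, hV, ← rep_mul_apply])
  refine ⟨c, sub_eq_zero.1 (eq_zero_of_rep_eq_zero π hξ fun a => ?_)⟩
  rw [map_sub, map_smul, ← hc, hV, sub_self]

theorem inner_rep_eq_of_isSelfAdjoint (π : B →⋆ₙₐ[ℂ] (H →L[ℂ] H)) {p q : H}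
    (h : ∀ a : B, IsSelfAdjoint a → ⟪p, π a p⟫_ℂ = ⟪q, π a q⟫_ℂ) (a : B) :
    ⟪p, π a p⟫_ℂ = ⟪q, π a q⟫_ℂ := by
  have hs := realPart_add_I_smul_imaginaryPart a
  rw [← hs]
  simp only [map_add, map_smul, add_apply, smul_apply, inner_add_right, inner_smul_right]
  rw [h _ (realPart a).2, h _ (imaginaryPart a).2]

theorem im_inner_rep_self (π : B →⋆ₙₐ[ℂ] (H →L[ℂ] H)) {a : B} (ha : IsSelfAdjoint a) (z : H) :
    (⟪z, π a z⟫_ℂ).im = 0 := by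
  rw [← Complex.conj_eq_iff_im, inner_conj_symm, inner_rep_left, ha.star_eq]

theorem IrreducibleRep.eq_zero_of_re_inner_eq_zero {π : B →⋆ₙₐ[ℂ] (H →L[ℂ] H)}
    (hπ : IrreducibleRep π) {ξ : H} (hξ : DenseRange fun a => π a ξ) {ζ ν : H} (hζ : ζ ≠ 0)
    (him : (⟪ζ, ν⟫_ℂ).im = 0) (hre : ∀ a : B, IsSelfAdjoint a → (⟪ν, π a ζ⟫_ℂ).re = 0) :
    ν = 0 := by
  have hfun : ∀ a : B, ⟪ζ + ν, π a (ζ + ν)⟫_ℂ = ⟪ζ - ν, π a (ζ - ν)⟫_ℂ := by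
    refine inner_rep_eq_of_isSelfAdjoint π fun a ha => ?_
    have h1 : ⟪ζ, π a ν⟫_ℂ = - ⟪ν, π a ζ⟫_ℂ := by
      rw [inner_rep_right, ha.star_eq, ← inner_conj_symm]
      have h2 : ∀ z : ℂ, z.re = 0 → (starRingEnd ℂ) z = -z := fun z hz =>
        Complex.ext (by simp [hz]) (by simp)
      exact h2 _ (hre a ha)
    simp only [map_add, map_sub, inner_add_left, inner_add_right, inner_sub_left, inner_sub_right,
      h1]
    ring
  by_cases hp : ζ + ν = 0
  · have h0 : ζ - ν = 0 := eq_zero_of_inner_rep_self_eq_zero π hξ fun a => by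
      rw [← hfun a, hp, inner_zero_left]
    refine absurd ?_ hζ
    have h2 : (2 : ℂ) • ζ = (ζ + ν) + (ζ - ν) := by module
    rw [hp, h0, add_zero] at h2
    exact (smul_eq_zero.1 h2).resolve_left two_ne_zero
  obtain ⟨c, hc⟩ := hπ.eq_smul_of_inner_eq hξ hp hfun
  have hc' : (1 - c) • ζ = (1 + c) • ν := by
    have : (1 - c) • ζ - (1 + c) • ν = (ζ - ν) - c • (ζ + ν) := by module
    rw [hc, sub_self] at this
    exact sub_eq_zero.1 this
  have hc1 : 1 + c ≠ 0 := by
    intro h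
    rw [h, zero_smul] at hc'
    have h2 := (smul_eq_zero.1 hc').resolve_right hζ
    have : (2 : ℂ) = 0 := by linear_combination h + h2
    exact two_ne_zero this
  obtain ⟨k, rfl⟩ : ∃ k : ℂ, ν = k • ζ :=
    ⟨(1 + c)⁻¹ * (1 - c), by rw [mul_smul, hc', smul_smul, inv_mul_cancel₀ hc1, one_smul]⟩
  have hk : k.im = 0 := by
    rw [inner_smul_right, inner_self_eq_norm_sq_to_K] at him
    have h2 : k.im * ‖ζ‖ ^ 2 = 0 := by
      simpa [← Complex.ofReal_pow] using him
    exact (mul_eq_zero.1 h2).resolve_right (by positivity)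
  by_contra hne
  have hk0 : k.re ≠ 0 := by
    intro h
    exact hne (by rw [show k = 0 from Complex.ext h hk, zero_smul])
  refine hζ (eq_zero_of_inner_rep_self_eq_zero π hξ fun a => ?_)
  have := inner_rep_eq_of_isSelfAdjoint π (p := ζ) (q := 0) (fun a ha => by
    have h1 := hre a ha
    rw [inner_smul_left] at h1
    have h2 := im_inner_rep_self π ha ζ
    rw [inner_zero_left]
    refine Complex.ext ?_ h2
    simpa [hk, hk0] using h1) a
  simpa using this

theorem IrreducibleRep.exists_isSelfAdjoint_norm_sub_lt {π : B →⋆ₙₐ[ℂ] (H →L[ℂ] H)}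
    (hπ : IrreducibleRep π) {ξ : H} (hξ : DenseRange fun a => π a ξ) {ζ μ : H} (hζ : ζ ≠ 0)
    (him : (⟪ζ, μ⟫_ℂ).im = 0) {ε : ℝ} (hε : 0 < ε) :
    ∃ a : B, IsSelfAdjoint a ∧ ‖π a ζ - μ‖ < ε := by
  let _ : InnerProductSpace ℝ H := InnerProductSpace.complexToReal
  let M : Submodule ℝ H :=
    { carrier := {x | ∃ a : B, IsSelfAdjoint a ∧ π a ζ = x}
      add_mem' := by
        rintro _ _ ⟨a, ha, rfl⟩ ⟨b, hb, rfl⟩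
        exact ⟨a + b, ha.add hb, by simp⟩
      zero_mem' := ⟨0, IsSelfAdjoint.zero B, by simp⟩
      smul_mem' := by
        rintro r _ ⟨a, ha, rfl⟩
        refine ⟨(r : ℂ) • a, ?_, by rw [map_smul]; rfl⟩
        rw [isSelfAdjoint_iff, star_smul, ha.star_eq]
        simp }
  set K := M.topologicalClosure with hK
  have hKc : IsClosed (K : Set H) := Submodule.isClosed_topologicalClosure _
  have : CompleteSpace K := hKc.completeSpace_coe
  obtain ⟨m, hm, ν, hν, rfl⟩ := K.exists_add_mem_mem_orthogonal μ
  have hmim : (⟪ζ, m⟫_ℂ).im = 0 := by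
    have hcl : IsClosed {x : H | (⟪ζ, x⟫_ℂ).im = 0} :=
      isClosed_eq (by fun_prop) (by fun_prop)
    have hsub : (M : Set H) ⊆ {x : H | (⟪ζ, x⟫_ℂ).im = 0} := by
      rintro _ ⟨a, ha, rfl⟩
      exact im_inner_rep_self π ha ζ
    exact closure_minimal hsub hcl hm
  have hν0 : ν = 0 := by
    refine hπ.eq_zero_of_re_inner_eq_zero hξ hζ ?_ fun a ha => ?_
    · rw [inner_add_right, Complex.add_im, hmim, zero_add] at him
      exact him
    · exact (Submodule.mem_orthogonal' _ _).1 hν _ (Submodule.le_topologicalClosure _ ⟨a, ha, rfl⟩)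
  have hm' : m ∈ closure (M : Set H) := hm
  obtain ⟨_, ⟨a, ha, rfl⟩, hlt⟩ := Metric.mem_closure_iff.1 hm' ε hε
  refine ⟨a, ha, ?_⟩
  rwa [hν0, add_zero, ← dist_eq_norm, dist_comm]

theorem IsSelfAdjoint.exists_mul_sub_I_smul_eq {a : B} (ha : IsSelfAdjoint a) :
    ∃ c : B, ‖c‖ ≤ 2 ∧ c * a - Complex.I • c = a := by
  have hpos : ∀ t : ℝ, 1 + t ^ 2 ≠ 0 := fun t => by positivity
  set c₁ := cfcₙ (fun t : ℝ => t ^ 2 / (1 + t ^ 2)) a with hc₁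
  set c₂ := cfcₙ (fun t : ℝ => t / (1 + t ^ 2)) a with hc₂
  have hcont₁ : Continuous fun t : ℝ => t ^ 2 / (1 + t ^ 2) :=
    by fun_prop (disch := exact hpos)
  have hcont₂ : Continuous fun t : ℝ => t / (1 + t ^ 2) :=
    by fun_prop (disch := exact hpos)
  have hid : cfcₙ (fun t : ℝ => t) a = a := cfcₙ_id' ℝ a
  have h₁ : c₂ * a = c₁ := by
    conv_lhs => rw [← hid]
    rw [hc₂, hc₁, ← cfcₙ_mul _ _ a hcont₂.continuousOn (by simp) (by fun_prop) (by simp)]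
    congr 1
    ext t
    ring
  have h₂ : c₁ * a + c₂ = a := by
    conv_lhs => enter [1, 2]; rw [← hid]
    rw [hc₂, hc₁, ← cfcₙ_mul _ _ a hcont₁.continuousOn (by simp) (by fun_prop) (by simp),
      ← cfcₙ_add (a := a) (fun t : ℝ => t ^ 2 / (1 + t ^ 2) * t) (fun t : ℝ => t / (1 + t ^ 2))
        (hcont₁.mul continuous_id).continuousOn (by simp) hcont₂.continuousOn (by simp)]
    conv_rhs => rw [← hid]
    congr 1
    ext t
    have := hpos t
    field_simp
    ring
  refine ⟨c₁ + Complex.I • c₂, ?_, ?_⟩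
  · have n₁ : ‖c₁‖ ≤ 1 := norm_cfcₙ_le fun t _ => by
      rw [Real.norm_eq_abs, abs_of_nonneg (by positivity), div_le_one (by positivity)]
      linarith
    have n₂ : ‖c₂‖ ≤ 1 := norm_cfcₙ_le fun t _ => by
      rw [Real.norm_eq_abs, abs_div, abs_of_pos (by positivity : 0 < 1 + t ^ 2),
        div_le_one (by positivity), abs_le]
      constructor <;> nlinarith [sq_nonneg (t - 1), sq_nonneg (t + 1)]
    calc ‖c₁ + Complex.I • c₂‖ ≤ ‖c₁‖ + ‖Complex.I • c₂‖ := norm_add_le _ _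
      _ = ‖c₁‖ + ‖c₂‖ := by rw [norm_smul, Complex.norm_I, one_mul]
      _ ≤ 2 := by linarith
  · rw [add_mul, smul_mul_assoc, h₁, smul_add, smul_smul, Complex.I_mul_I]
    refine Eq.trans ?_ h₂
    module

/-- A Cayley transform moves `ξ` close to the midpoint of `ξ` and `v`. -/
theorem IrreducibleRep.exists_norm_sub_midpoint_lt {π : B →⋆ₙₐ[ℂ] (H →L[ℂ] H)}
    (hπ : IrreducibleRep π) {ξ : H} (hξ : DenseRange fun a => π a ξ) {v : H} (hv : ‖v‖ = ‖ξ‖)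
    (hne : v ≠ ξ) {ε : ℝ} (hε : 0 < ε) :
    ∃ c : B, ‖c‖ ≤ 2 ∧ ‖π c ξ - (1 / 2 : ℂ) • (ξ + v)‖ < ε := by
  set ζ : H := (Complex.I / 2) • (ξ - v) with hζ
  set η : H := (1 / 2 : ℂ) • (ξ + v) with hη
  have hζ0 : ζ ≠ 0 := by
    rw [hζ]
    exact smul_ne_zero (by simp) (sub_ne_zero.2 hne.symm)
  have him : (⟪ζ, η⟫_ℂ).im = 0 := by
    have h2 : (starRingEnd ℂ) (Complex.I / 2) = -(Complex.I / 2) := by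
      rw [map_div₀, Complex.conj_I, Complex.conj_ofNat, neg_div]
    rw [hζ, hη, inner_smul_left, inner_smul_right, h2, inner_sub_left, inner_add_right,
      inner_add_right, inner_self_eq_norm_sq_to_K, inner_self_eq_norm_sq_to_K, hv,
      ← inner_conj_symm v ξ]
    generalize ⟪ξ, v⟫_ℂ = z
    simp [← Complex.ofReal_pow]
    ring
  have hξη : η - Complex.I • ζ = ξ := by
    rw [hη, hζ, smul_smul, ← mul_div_assoc, Complex.I_mul_I]
    module
  obtain ⟨a, ha, hlt⟩ :=
    hπ.exists_isSelfAdjoint_norm_sub_lt hξ hζ0 him (show 0 < ε / 3 by positivity)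
  obtain ⟨c, hc, hca⟩ := ha.exists_mul_sub_I_smul_eq
  refine ⟨c, hc, ?_⟩
  have hcζ : π c (π a ζ) - Complex.I • π c ζ = π a ζ := by
    have := congrArg (fun b => π b ζ) hca
    simpa [rep_mul_apply] using this
  have hkey : π c ξ - η = (π a ζ - η) - π c (π a ζ - η) := by
    have : π c ξ = π c η - Complex.I • π c ζ := by rw [← map_smul, ← map_sub, hξη]
    rw [this, map_sub, sub_eq_iff_eq_add.1 hcζ]
    abel
  rw [hkey]
  have hπc : ‖π c (π a ζ - η)‖ ≤ 2 * ‖π a ζ - η‖ :=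
    ((π c).le_opNorm _).trans (by
      gcongr
      exact (NonUnitalStarAlgHom.norm_apply_le π c).trans hc)
  have := norm_sub_le (π a ζ - η) (π c (π a ζ - η))
  linarith

/-- **Kadison transitivity**, approximate form with norm control. -/
theorem IrreducibleRep.exists_norm_le_norm_sub_lt {π : B →⋆ₙₐ[ℂ] (H →L[ℂ] H)}
    (hπ : IrreducibleRep π) {ξ : H} (hξ : DenseRange fun a => π a ξ) {v : H} (hv : ‖v‖ = ‖ξ‖)
    {ε : ℝ} (hε : 0 < ε) : ∃ d : B, ‖d‖ ≤ 4 ∧ ‖π d ξ - v‖ < ε := by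
  have main : ∀ w : H, ‖w‖ = ‖ξ‖ → w ≠ ξ → -w ≠ ξ → ∃ d : B, ‖d‖ ≤ 4 ∧ ‖π d ξ - w‖ < ε := by
    intro w hw h1 h2
    obtain ⟨c, hc, hcl⟩ := hπ.exists_norm_sub_midpoint_lt hξ hw h1 (half_pos hε)
    obtain ⟨c', hc', hcl'⟩ :=
      hπ.exists_norm_sub_midpoint_lt hξ ((norm_neg w).trans hw) h2 (half_pos hε)
    refine ⟨c - c', (norm_sub_le _ _).trans (by linarith), ?_⟩
    have : π (c - c') ξ - w = (π c ξ - (1 / 2 : ℂ) • (ξ + w)) -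
        (π c' ξ - (1 / 2 : ℂ) • (ξ + -w)) := by
      rw [map_sub, sub_apply]
      module
    rw [this]
    exact (norm_sub_le _ _).trans_lt (by linarith)
  by_cases hξ0 : ξ = 0
  · refine ⟨0, by simp, ?_⟩
    have : v = 0 := by rw [← norm_eq_zero, hv, hξ0, norm_zero]
    simpa [this] using hε
  by_cases h : v ≠ ξ ∧ -v ≠ ξ
  · exact main v hv h.1 h.2
  have hI : ∀ z : ℂ, z ≠ 1 → z • ξ ≠ ξ := fun z hz h => hz <| by
    have : (z - 1) • ξ = 0 := by rw [sub_smul, h, one_smul, sub_self]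
    exact sub_eq_zero.1 ((smul_eq_zero.1 this).resolve_right hξ0)
  have hI₁ : Complex.I • ξ ≠ ξ := hI _ fun h => by simpa using congrArg Complex.im h
  have hI₂ : (-Complex.I) • ξ ≠ ξ := hI _ fun h => by simpa using congrArg Complex.im h
  have hv' : Complex.I • v ≠ ξ ∧ -(Complex.I • v) ≠ ξ := by
    rcases not_and_or.1 h with h | h
    · rw [not_not.1 h, ← neg_smul]
      exact ⟨hI₁, hI₂⟩
    · rw [← neg_neg v, not_not.1 h, smul_neg, neg_neg, ← neg_smul]
      exact ⟨hI₂, hI₁⟩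
  obtain ⟨d, hd, hdl⟩ :=
    main (Complex.I • v) (by rw [norm_smul, Complex.norm_I, one_mul, hv]) hv'.1 hv'.2
  refine ⟨-Complex.I • d, by rwa [norm_smul, norm_neg, Complex.norm_I, one_mul], ?_⟩
  have : π (-Complex.I • d) ξ - v = -Complex.I • (π d ξ - Complex.I • v) := by
    rw [map_smul, smul_apply, smul_sub, smul_smul, neg_mul, Complex.I_mul_I, neg_neg, one_smul]
  rwa [this, norm_smul, norm_neg, Complex.norm_I, one_mul]

theorem ContinuousLinearMap.exists_preimage_of_approx {E F : Type*} [NormedAddCommGroup E]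
    [NormedSpace ℂ E] [CompleteSpace E] [NormedAddCommGroup F] [NormedSpace ℂ F]
    (T : E →L[ℂ] F) {C : ℝ}
    (hT : ∀ y, ∃ x, ‖T x - y‖ ≤ 1 / 2 * ‖y‖ ∧ ‖x‖ ≤ C * ‖y‖) (y : F) :
    ∃ x, T x = y ∧ ‖x‖ ≤ 2 * C * ‖y‖ := by
  choose g hg hgn using hT
  let h : F → F := fun z => z - T (g z)
  have hle : ∀ n : ℕ, ‖h^[n] y‖ ≤ (1 / 2) ^ n * ‖y‖ := by
    intro n
    induction n with
    | zero => simp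
    | succ n ih =>
      rw [Function.iterate_succ_apply']
      have := hg (h^[n] y)
      rw [norm_sub_rev] at this
      refine this.trans ?_
      rw [pow_succ', mul_assoc]
      gcongr
  by_cases hC : C < 0
  · have hy : ‖y‖ = 0 := by
      by_contra hne
      have h1 : 0 < ‖y‖ := lt_of_le_of_ne (norm_nonneg _) (Ne.symm hne)
      have := (norm_nonneg _).trans (hgn y)
      nlinarith
    exact ⟨0, by rw [map_zero, norm_eq_zero.1 hy], by simp [hy]⟩
  rw [not_lt] at hC
  have hu : ∀ n, ‖g (h^[n] y)‖ ≤ (1 / 2) ^ n * (C * ‖y‖) := fun n =>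
    (hgn _).trans (by
      calc C * ‖h^[n] y‖ ≤ C * ((1 / 2) ^ n * ‖y‖) := by gcongr; exact hle n
        _ = _ := by ring)
  have hgeo : HasSum (fun n : ℕ => (1 / 2 : ℝ) ^ n * (C * ‖y‖)) (2 * (C * ‖y‖)) :=
    hasSum_geometric_two.mul_right _
  have hsum : Summable fun n => g (h^[n] y) := Summable.of_norm_bounded hgeo.summable hu
  refine ⟨∑' n, g (h^[n] y), ?_, ?_⟩
  · have hpart : ∀ n, T (∑ i ∈ Finset.range n, g (h^[i] y)) = y - h^[n] y := by
      intro n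
      induction n with
      | zero => simp
      | succ n ih =>
        rw [Finset.sum_range_succ, map_add, ih, Function.iterate_succ_apply']
        simp only [h]
        abel
    have hlim : Tendsto (fun n => y - h^[n] y) atTop (𝓝 (y - 0)) := by
      refine tendsto_const_nhds.sub (squeeze_zero_norm hle ?_)
      rw [← zero_mul ‖y‖]
      exact (tendsto_pow_atTop_nhds_zero_of_lt_one (by norm_num) (by norm_num)).mul_const _
    rw [sub_zero] at hlim
    refine tendsto_nhds_unique ?_ hlim
    simp only [← hpart]
    exact (T.continuous.tendsto _).comp hsum.hasSum.tendsto_sum_nat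
  · rw [mul_assoc]
    exact tsum_of_norm_bounded hgeo hu

/-- **Kadison transitivity** with norm control: a cyclic vector reaches every vector. -/
theorem IrreducibleRep.exists_rep_eq {π : B →⋆ₙₐ[ℂ] (H →L[ℂ] H)}
    (hπ : IrreducibleRep π) {ξ : H} (hξ : DenseRange fun a => π a ξ) :
    ∃ C : ℝ, ∀ η : H, ∃ a : B, π a ξ = η ∧ ‖a‖ ≤ C * ‖η‖ := by
  by_cases hξ0 : ξ = 0
  · refine ⟨0, fun η => ⟨0, ?_, by simp⟩⟩
    have : η = 0 := eq_zero_of_rep_eq_zero π hξ fun a => ?_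
    · simp [this]
    · have h0 : ∀ x : H, x = 0 := fun x => hξ.induction_on (p := fun x => x = 0) x
        (isClosed_eq continuous_id continuous_const) fun a => by rw [hξ0, map_zero]
      exact h0 _
  have hξn : 0 < ‖ξ‖ := norm_pos_iff.2 hξ0
  let T : B →L[ℂ] H := (orbitMap π ξ).mkContinuous ‖ξ‖ fun a => by
    rw [mul_comm]
    exact ((π a).le_opNorm ξ).trans (by
      gcongr
      exact NonUnitalStarAlgHom.norm_apply_le π a)
  refine ⟨2 * (4 / ‖ξ‖), T.exists_preimage_of_approx fun y => ?_⟩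
  by_cases hy : y = 0
  · exact ⟨0, by simp [hy], by simp [hy]⟩
  have hyn : 0 < ‖y‖ := norm_pos_iff.2 hy
  have hr : ‖((‖y‖ / ‖ξ‖ : ℝ) : ℂ)‖ = ‖y‖ / ‖ξ‖ := by
    rw [Complex.norm_real, Real.norm_of_nonneg (by positivity)]
  have hr' : ((‖y‖ / ‖ξ‖ : ℝ) : ℂ) ≠ 0 := by
    rw [← norm_ne_zero_iff, hr]
    positivity
  have hv : ‖((‖y‖ / ‖ξ‖ : ℝ) : ℂ)⁻¹ • y‖ = ‖ξ‖ := by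
    rw [norm_smul, norm_inv, hr]
    field_simp
  obtain ⟨d, hd, hdl⟩ := hπ.exists_norm_le_norm_sub_lt hξ hv (half_pos hξn)
  refine ⟨((‖y‖ / ‖ξ‖ : ℝ) : ℂ) • d, ?_, ?_⟩
  · have : T (((‖y‖ / ‖ξ‖ : ℝ) : ℂ) • d) - y =
        ((‖y‖ / ‖ξ‖ : ℝ) : ℂ) • (π d ξ - ((‖y‖ / ‖ξ‖ : ℝ) : ℂ)⁻¹ • y) := by
      rw [map_smul, smul_sub, smul_smul, mul_inv_cancel₀ hr', one_smul]
      rfl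
    rw [this, norm_smul, hr]
    calc ‖y‖ / ‖ξ‖ * ‖π d ξ - ((‖y‖ / ‖ξ‖ : ℝ) : ℂ)⁻¹ • y‖ ≤ ‖y‖ / ‖ξ‖ * (‖ξ‖ / 2) := by gcongr
      _ = 1 / 2 * ‖y‖ := by field_simp
  · rw [norm_smul, hr]
    calc ‖y‖ / ‖ξ‖ * ‖d‖ ≤ ‖y‖ / ‖ξ‖ * 4 := by gcongr
      _ = 4 / ‖ξ‖ * ‖y‖ := by ring

end Representation
section PureState

open Filter Topology InnerProductSpace

/-- Positive functionals dominated by `f` are multiples of `f`. -/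
def PureFunctional (f : A →L[ℂ] ℂ) : Prop :=
  ∀ g : A →L[ℂ] ℂ, (∀ a : A, 0 ≤ a → 0 ≤ g a) → (∀ a : A, 0 ≤ a → g a ≤ f a) →
    ∃ t : ℝ, 0 ≤ t ∧ t ≤ 1 ∧ g = (t : ℂ) • f

variable {H : Type*} [NormedAddCommGroup H] [InnerProductSpace ℂ H] [CompleteSpace H]

theorem PureFunctional.irreducibleRep {f : A →L[ℂ] ℂ} (hf : PureFunctional f)
    {π : A →⋆ₙₐ[ℂ] (H →L[ℂ] H)} {ξ : H} (hξ : DenseRange fun a => π a ξ)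
    (hfξ : ∀ a, f a = ⟪ξ, π a ξ⟫_ℂ) : IrreducibleRep π := by
  intro W hW hcomm
  set r : ℝ := ‖W‖ + 1 with hr
  have hr0 : 0 < r := by positivity
  let T : A →L[ℂ] H := (orbitMap π ξ).mkContinuous ‖ξ‖ fun a => by
    rw [mul_comm]
    exact ((π a).le_opNorm ξ).trans (by
      gcongr
      exact NonUnitalStarAlgHom.norm_apply_le π a)
  have hT : ∀ a, T a = π a ξ := fun a => rfl
  let g : A →L[ℂ] ℂ := ((2 * r : ℝ) : ℂ)⁻¹ • ((innerSL ℂ ξ) ∘L W ∘L T + (r : ℂ) • f)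
  have hg : ∀ a, g a = ((2 * r : ℝ) : ℂ)⁻¹ * (⟪ξ, W (π a ξ)⟫_ℂ + r * f a) := fun a => rfl
  have hmove : ∀ a b, ⟪ξ, W (π (star a * b) ξ)⟫_ℂ = ⟪π a ξ, W (π b ξ)⟫_ℂ := by
    intro a b
    rw [rep_mul_apply, hcomm, ← inner_rep_left]
  have hfmove : ∀ a b, f (star a * b) = ⟪π a ξ, π b ξ⟫_ℂ := by
    intro a b
    rw [hfξ, rep_mul_apply, ← inner_rep_left]
  have hreal : ∀ x, ∃ s : ℝ, ⟪x, W x⟫_ℂ = s ∧ |s| ≤ r * ‖x‖ ^ 2 := by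
    intro x
    have hsym : (starRingEnd ℂ) ⟪x, W x⟫_ℂ = ⟪x, W x⟫_ℂ := by
      rw [inner_conj_symm, ← ContinuousLinearMap.adjoint_inner_right,
        ← ContinuousLinearMap.star_eq_adjoint, hW.star_eq]
    obtain ⟨s, hs⟩ := Complex.conj_eq_iff_real.1 hsym
    refine ⟨s, hs, ?_⟩
    have h1 : |s| = ‖⟪x, W x⟫_ℂ‖ := by rw [hs, Complex.norm_real, Real.norm_eq_abs]
    rw [h1]
    calc ‖⟪x, W x⟫_ℂ‖ ≤ ‖x‖ * ‖W x‖ := norm_inner_le_norm _ _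
      _ ≤ ‖x‖ * (‖W‖ * ‖x‖) := by gcongr; exact W.le_opNorm x
      _ ≤ r * ‖x‖ ^ 2 := by nlinarith [sq_nonneg ‖x‖]
  have hgform : ∀ b, ∃ s : ℝ, |s| ≤ r * ‖π b ξ‖ ^ 2 ∧
      g (star b * b) = (((2 * r)⁻¹ * (s + r * ‖π b ξ‖ ^ 2) : ℝ) : ℂ) ∧
      f (star b * b) = ((‖π b ξ‖ ^ 2 : ℝ) : ℂ) := by
    intro b
    obtain ⟨s, hs, hs'⟩ := hreal (π b ξ)
    have hfb : f (star b * b) = ((‖π b ξ‖ ^ 2 : ℝ) : ℂ) := by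
      rw [hfmove, inner_self_eq_norm_sq_to_K]
      push_cast
      rfl
    refine ⟨s, hs', ?_, hfb⟩
    rw [hg, hmove, hs, hfb]
    push_cast
    rfl
  obtain ⟨t, -, -, ht⟩ := hf g
    (by
      intro a ha
      obtain ⟨b, rfl⟩ := CStarAlgebra.nonneg_iff_eq_star_mul_self.1 ha
      obtain ⟨s, hs, hgs, -⟩ := hgform b
      rw [hgs, Complex.zero_le_real]
      have := (abs_le.1 hs).1
      exact mul_nonneg (by positivity) (by linarith))
    (by
      intro a ha
      obtain ⟨b, rfl⟩ := CStarAlgebra.nonneg_iff_eq_star_mul_self.1 ha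
      obtain ⟨s, hs, hgs, hfs⟩ := hgform b
      rw [hgs, hfs, Complex.real_le_real, inv_mul_le_iff₀ (by positivity)]
      have := (abs_le.1 hs).2
      linarith)
  refine ⟨(2 * r * t - r : ℝ), fun x => ?_⟩
  refine hξ.induction_on (p := fun x => W x = ((2 * r * t - r : ℝ) : ℂ) • x) x
    (isClosed_eq (by fun_prop) (by fun_prop)) fun b => ?_
  rw [← sub_eq_zero]
  refine hξ.eq_zero_of_inner_right ℂ fun a => ?_
  have h1 := hg (star a * b)
  rw [ht, hmove, smul_apply, smul_eq_mul, hfmove] at h1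
  have h2 : ((2 * r : ℝ) : ℂ) ≠ 0 := by
    rw [Complex.ofReal_ne_zero]
    positivity
  rw [eq_inv_mul_iff_mul_eq₀ h2] at h1
  rw [inner_sub_right, inner_smul_right]
  push_cast at h1 ⊢
  linear_combination -h1

theorem exists_norm_le_preGNS_norm (f : A →ₚ[ℂ] ℂ) {M : ℝ} (hM0 : 0 ≤ M)
    (hM : ∀ a, ‖f a‖ ≤ M * ‖a‖) :
    ∀ a : A, ‖f a‖ ≤ √M * ‖f.toPreGNS a‖ := by
  intro a
  have hl := CStarAlgebra.increasingApproximateUnit A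
  have hM1 : ∀ e : A, ‖e‖ ≤ 1 → ‖f (e * star e)‖ ≤ M := by
    intro e he
    refine (hM _).trans (mul_le_of_le_one_right hM0 ?_)
    rw [CStarRing.norm_self_mul_star]
    exact mul_le_one₀ he (norm_nonneg _) he
  have hcont : Continuous f := by
    have : Continuous (f.toLinearMap.mkContinuous M hM) := ContinuousLinearMap.continuous _
    exact this
  have hlim : Tendsto (fun e : A => ‖f (e * a)‖) (CStarAlgebra.approximateUnit A) (𝓝 ‖f a‖) :=
    (hcont.norm.tendsto _).comp (hl.tendsto_mul_right a)
  refine le_of_tendsto hlim ?_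
  filter_upwards [hl.eventually_norm] with e he
  have h1 : f (e * a) = ⟪f.toPreGNS (star e), f.toPreGNS a⟫_ℂ := by
    rw [PositiveLinearMap.preGNS_inner_def]
    simp
  rw [h1]
  refine (norm_inner_le_norm _ _).trans ?_
  gcongr
  rw [PositiveLinearMap.preGNS_norm_def]
  refine Real.sqrt_le_sqrt ((Complex.re_le_norm _).trans ?_)
  simpa using hM1 e he

/-- A form of the Riesz representation theorem for functionals bounded by a seminorm `‖e x‖`. -/
theorem exists_inner_eq_of_norm_le {V : Type*} [AddCommGroup V] [Module ℂ V] (e : V →ₗ[ℂ] H)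
    (φ : V →ₗ[ℂ] ℂ) {C : ℝ} (h : ∀ x, ‖φ x‖ ≤ C * ‖e x‖) :
    ∃ v : H, ∀ x, ⟪v, e x⟫_ℂ = φ x := by
  set R := (LinearMap.range e).topologicalClosure with hR
  have hRc : IsClosed (R : Set H) := Submodule.isClosed_topologicalClosure _
  have : CompleteSpace R := hRc.completeSpace_coe
  let e' : V →ₗ[ℂ] R := e.codRestrict R fun x =>
    Submodule.le_topologicalClosure _ (LinearMap.mem_range_self e x)
  have hd : DenseRange e' := by
    intro y
    rw [closure_subtype]
    have hy : (y : H) ∈ closure (LinearMap.range e : Set H) := y.2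
    convert hy using 2
    ext z
    constructor
    · rintro ⟨_, ⟨x, rfl⟩, rfl⟩
      exact ⟨x, rfl⟩
    · rintro ⟨x, rfl⟩
      exact ⟨e' x, ⟨x, rfl⟩, rfl⟩
  refine ⟨((InnerProductSpace.toDual ℂ R).symm (φ.extendOfNorm e') : R), fun x => ?_⟩
  have h1 := InnerProductSpace.toDual_symm_apply (𝕜 := ℂ) (x := e' x) (y := φ.extendOfNorm e')
  rw [LinearMap.extendOfNorm_eq hd ⟨C, h⟩] at h1
  exact h1

universe u in
/-- A pure state is represented by a surjective GNS map admitting norm-controlled preimages. -/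
theorem PureFunctional.exists_gns {A : Type u} [NonUnitalCStarAlgebra A] [PartialOrder A]
    [StarOrderedRing A] {f : A →L[ℂ] ℂ} (hf : PureFunctional f)
    (hpos : ∀ a : A, 0 ≤ a → 0 ≤ f a) :
    ∃ (H : Type u) (_ : NormedAddCommGroup H) (_ : InnerProductSpace ℂ H) (_ : CompleteSpace H)
      (e : A →ₗ[ℂ] H) (C : ℝ), (∀ a b, ⟪e a, e b⟫_ℂ = f (star a * b)) ∧
      ∀ η, ∃ a, e a = η ∧ ‖a‖ ≤ C * ‖η‖ := by
  let F : A →ₚ[ℂ] ℂ := PositiveLinearMap.mk₀ f.toLinearMap hpos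
  have hF : ∀ a, F a = f a := fun a => rfl
  let e : A →ₗ[ℂ] F.GNS :=
    (UniformSpace.Completion.toComplL (𝕜 := ℂ) (E := F.PreGNS)).toLinearMap ∘ₗ
      F.toPreGNS.toLinearMap
  have he : ∀ a, e a = (F.toPreGNS a : F.GNS) := fun a => rfl
  have hinner : ∀ a b, ⟪e a, e b⟫_ℂ = f (star a * b) := by
    intro a b
    rw [he, he, UniformSpace.Completion.inner_coe, PositiveLinearMap.preGNS_inner_def]
    rfl
  have hdense : DenseRange e :=
    UniformSpace.Completion.denseRange_coe.comp F.toPreGNS.surjective.denseRange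
      (UniformSpace.Completion.continuous_coe _)
  have hbound := exists_norm_le_preGNS_norm F (norm_nonneg f) f.le_opNorm
  obtain ⟨ξ, hξ⟩ := exists_inner_eq_of_norm_le e f.toLinearMap (C := √‖f‖) fun a => by
    rw [he, UniformSpace.Completion.norm_coe]
    exact hbound a
  have hπ : ∀ a b, F.gnsNonUnitalStarAlgHom a (e b) = e (a * b) := by
    intro a b
    rw [he, he, PositiveLinearMap.gnsNonUnitalStarAlgHom_apply_coe]
    rfl
  have hπξ : ∀ b, F.gnsNonUnitalStarAlgHom b ξ = e b := by
    intro b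
    refine hdense.eq_of_inner_left ℂ fun a => ?_
    rw [inner_rep_left, hπ, hξ, hinner]
    rfl
  have hcyc : DenseRange fun a => F.gnsNonUnitalStarAlgHom a ξ := by
    simpa only [hπξ] using hdense
  obtain ⟨C, hC⟩ := (hf.irreducibleRep hcyc fun a => by
    rw [hπξ]; exact (hξ a).symm).exists_rep_eq hcyc
  refine ⟨F.GNS, inferInstance, inferInstance, inferInstance, e, C, hinner, fun η => ?_⟩
  obtain ⟨a, ha, hn⟩ := hC η
  exact ⟨a, by rw [← hπξ, ha], hn⟩

end PureState

section HilbertModule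

open Filter Topology InnerProductSpace

theorem Summable.of_nonneg_of_le_of_cstar {a b : ℕ → A} (ha : ∀ n, 0 ≤ a n)
    (hab : ∀ n, a n ≤ b n) (hb : Summable b) : Summable a := by
  rw [summable_iff_vanishing_norm] at hb ⊢
  intro ε hε
  obtain ⟨s, hs⟩ := hb ε hε
  exact ⟨s, fun t ht => (CStarAlgebra.norm_le_norm_of_nonneg_of_le
    (Finset.sum_nonneg fun i _ => ha i) (Finset.sum_le_sum fun i _ => hab i)).trans_lt (hs t ht)⟩

theorem summable_star_add_mul_add {x y : ℕ → A} (hx : Summable fun n => star (x n) * x n)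
    (hy : Summable fun n => star (y n) * y n) :
    Summable fun n => star (x n + y n) * (x n + y n) := by
  refine .of_nonneg_of_le_of_cstar (fun n => star_mul_self_nonneg _) (fun n => ?_)
    ((hx.add hy).add (hx.add hy))
  rw [← sub_nonneg]
  convert star_mul_self_nonneg (x n - y n) using 1
  simp only [star_add, star_sub, add_mul, mul_add, sub_mul, mul_sub]
  abel

theorem summable_star_smul_mul_smul {B : Type*} [NonUnitalCStarAlgebra B] {x : ℕ → B}
    (hx : Summable fun n => star (x n) * x n) (c : ℂ) :
    Summable fun n => star (c • x n) * (c • x n) := by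
  simp only [star_smul, smul_mul_smul_comm]
  exact hx.const_smul _

theorem summable_star_mul {x y : ℕ → A} (hx : Summable fun n => star (x n) * x n)
    (hy : Summable fun n => star (y n) * y n) : Summable fun n => star (x n) * y n := by
  have h1 := ((summable_star_add_mul_add hx hy).sub hx).sub hy
  have hIy := summable_star_smul_mul_smul hy Complex.I
  have h2 := ((summable_star_add_mul_add hx hIy).sub hx).sub hy
  refine ((h1.sub (h2.const_smul Complex.I)).const_smul (2⁻¹ : ℂ)).congr fun n => ?_
  simp only [star_add, star_smul, add_mul, mul_add, smul_mul_assoc, mul_smul_comm,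
    smul_add, smul_sub, smul_smul, Complex.star_def, Complex.conj_I]
  simp only [mul_neg, Complex.I_mul_I, neg_neg, mul_one]
  module

/-- The difference of two elements of `l²(A)`. -/
def l2Sub (x y : l2 A) : l2 A :=
  ⟨fun n => x.1 n + (-1 : ℂ) • y.1 n,
    summable_star_add_mul_add x.2 (summable_star_smul_mul_smul y.2 _)⟩

variable {H : Type*} [NormedAddCommGroup H] [InnerProductSpace ℂ H]
  {f : A →L[ℂ] ℂ} {e : A →ₗ[ℂ] H}

/-- The map `l²(A) → ℓ²(H)` induced by the GNS map `e : A → H` of a functional `f`. -/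
noncomputable def l2GnsMap (he : ∀ a b, ⟪e a, e b⟫_ℂ = f (star a * b)) (x : l2 A) :
    lp (fun _ : ℕ => H) 2 :=
  ⟨fun n => e (x.1 n), by
    change Memℓp _ 2
    rw [memℓp_gen_iff (by norm_num), ← Complex.summable_ofReal]
    have h := f.summable x.2
    simp only [← he, inner_self_eq_norm_sq_to_K] at h
    simpa using h⟩

theorem inner_l2GnsMap (he : ∀ a b, ⟪e a, e b⟫_ℂ = f (star a * b)) (x y : l2 A) :
    ⟪l2GnsMap he x, l2GnsMap he y⟫_ℂ = f (l2Inner x y) := by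
  rw [lp.inner_eq_tsum, l2Inner, f.map_tsum (summable_star_mul x.2 y.2)]
  exact tsum_congr fun n => he _ _

theorem l2GnsMap_sub (he : ∀ a b, ⟪e a, e b⟫_ℂ = f (star a * b)) (x y : l2 A) :
    l2GnsMap he (l2Sub x y) = l2GnsMap he x - l2GnsMap he y := by
  ext n
  change e (x.1 n + (-1 : ℂ) • y.1 n) = e (x.1 n) - e (y.1 n)
  rw [map_add, map_smul]
  module

theorem l2GnsMap_surjective (he : ∀ a b, ⟪e a, e b⟫_ℂ = f (star a * b)) {C : ℝ}
    (hC : ∀ η, ∃ a, e a = η ∧ ‖a‖ ≤ C * ‖η‖) : Function.Surjective (l2GnsMap he) := by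
  intro ω
  choose g hg hgn using hC
  have hω : Summable fun n => ‖ω n‖ ^ 2 := by
    simpa using (memℓp_gen_iff (by norm_num)).1 (lp.memℓp ω)
  refine ⟨⟨fun n => g (ω n), .of_norm_bounded (hω.mul_left (C ^ 2)) fun n => ?_⟩, ?_⟩
  · rw [CStarRing.norm_star_mul_self, ← mul_pow, ← sq]
    gcongr
    exact hgn _
  · ext n
    exact hg _

/-- An adjointable pair on `l²(A)` descends to a linear map on `ℓ²(H)`. -/
theorem exists_linearMap_adjoint (he : ∀ a b, ⟪e a, e b⟫_ℂ = f (star a * b))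
    (hsurj : Function.Surjective (l2GnsMap he)) {T T' : l2 A → l2 A}
    (hT : ∀ x y : l2 A, l2Inner (T x) y = l2Inner x (T' y)) :
    ∃ L : lp (fun _ : ℕ => H) 2 →ₗ[ℂ] lp (fun _ : ℕ => H) 2,
      (∀ x, L (l2GnsMap he x) = l2GnsMap he (T' x)) ∧
      ∀ x k, ⟪l2GnsMap he x, L k⟫_ℂ = ⟪l2GnsMap he (T x), k⟫_ℂ := by
  have hd : DenseRange (l2GnsMap he) := hsurj.denseRange
  let s := Function.surjInv hsurj
  have hs : ∀ k, l2GnsMap he (s k) = k := Function.surjInv_eq hsurj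
  have hadj : ∀ x y, ⟪l2GnsMap he x, l2GnsMap he (T' y)⟫_ℂ =
      ⟪l2GnsMap he (T x), l2GnsMap he y⟫_ℂ := by
    intro x y
    rw [inner_l2GnsMap, inner_l2GnsMap, hT]
  let L : lp (fun _ : ℕ => H) 2 →ₗ[ℂ] lp (fun _ : ℕ => H) 2 :=
    { toFun k := l2GnsMap he (T' (s k))
      map_add' k l := by
        refine hd.eq_of_inner_right ℂ fun x => ?_
        simp only [inner_add_right, hadj, hs]
      map_smul' c k := by
        refine hd.eq_of_inner_right ℂ fun x => ?_
        simp only [inner_smul_right, hadj, hs, RingHom.id_apply] }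
  have hL : ∀ k, L k = l2GnsMap he (T' (s k)) := fun k => rfl
  refine ⟨L, fun y => ?_, fun x k => ?_⟩
  · refine hd.eq_of_inner_right ℂ fun x => ?_
    rw [hL, hadj, hs, hadj]
  · rw [hL, hadj, hs]

end HilbertModule


/-- If `A, B` are adjointable operators on `E = l²(A)` with `BB* ≤ λ AA*` for some `λ > 0`,
then for every pure state `f` on `A` one has `range B ⊆ range A + N_{E,f}`, where
`N_{E,f} = {x : f⟪x,x⟫ = 0}`. -/
theorem stmt_18 (T T' S S' : l2 A → l2 A)
    (hT : ∀ x y : l2 A, l2Inner (T x) y = l2Inner x (T' y))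
    (hS : ∀ x y : l2 A, l2Inner (S x) y = l2Inner x (S' y))
    (hle : ∃ lam : ℝ, 0 < lam ∧ ∀ x : l2 A,
      l2Inner x (S (S' x)) ≤ (lam : ℂ) • l2Inner x (T (T' x)))
    (f : A →L[ℂ] ℂ) (hf_pos : ∀ a : A, 0 ≤ a → 0 ≤ f a) (hf_norm : ‖f‖ = 1)
    (hf_pure : ∀ g : A →L[ℂ] ℂ, (∀ a : A, 0 ≤ a → 0 ≤ g a) →
      (∀ a : A, 0 ≤ a → g a ≤ f a) → ∃ t : ℝ, 0 ≤ t ∧ t ≤ 1 ∧ g = (t : ℂ) • f) :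
    ∀ y ∈ Set.range S, ∃ u ∈ Set.range T, ∃ n : l2 A,
      f (l2Inner n n) = 0 ∧ y.1 = fun i => u.1 i + n.1 i := by
  obtain ⟨lam, hlam, hle⟩ := hle
  obtain ⟨H, _, _, _, e, C, he, hC⟩ := PureFunctional.exists_gns hf_pure hf_pos
  have hsurj := l2GnsMap_surjective he hC
  obtain ⟨L, hLx, hL⟩ := exists_linearMap_adjoint he hsurj hT
  obtain ⟨M, hMx, hM⟩ := exists_linearMap_adjoint he hsurj hS
  have hmono : ∀ a b : A, a ≤ b → f a ≤ f b := fun a b hab => by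
    have := hf_pos _ (sub_nonneg.2 hab)
    rwa [map_sub, sub_nonneg] at this
  have hnorm : ∀ k, ‖M k‖ ≤ √lam * ‖L k‖ := by
    intro k
    obtain ⟨x, rfl⟩ := hsurj k
    have hself : ∀ R R' : l2 A → l2 A, (∀ x y, l2Inner (R x) y = l2Inner x (R' y)) →
        f (l2Inner x (R (R' x))) = ((‖l2GnsMap he (R' x)‖ ^ 2 : ℝ) : ℂ) := by
      intro R R' hR
      rw [← inner_l2GnsMap he, ← inner_conj_symm, inner_l2GnsMap, hR, ← inner_l2GnsMap he,
        inner_self_eq_norm_sq_to_K]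
      simp
    have h := hmono _ _ (hle x)
    rw [map_smul, hself S S' hS, hself T T' hT, smul_eq_mul, ← Complex.ofReal_mul,
      Complex.real_le_real, ← hLx, ← hMx] at h
    refine le_of_sq_le_sq ?_ (by positivity)
    rwa [mul_pow, Real.sq_sqrt hlam.le]
  rintro _ ⟨x, rfl⟩
  obtain ⟨v, hv⟩ := exists_inner_eq_of_norm_le L
    ((innerSL ℂ (l2GnsMap he x)).toLinearMap ∘ₗ M) (C := ‖l2GnsMap he x‖ * √lam) fun k => by
      refine (norm_inner_le_norm (𝕜 := ℂ) (l2GnsMap he x) (M k)).trans ?_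
      rw [mul_assoc]
      gcongr
      exact hnorm k
  obtain ⟨z, rfl⟩ := hsurj v
  have heq : l2GnsMap he (T z) = l2GnsMap he (S x) := by
    refine ext_inner_right ℂ fun k => ?_
    rw [← hL, ← hM, hv]
    rfl
  refine ⟨T z, ⟨z, rfl⟩, l2Sub (S x) (T z), ?_, ?_⟩
  · rw [← inner_l2GnsMap he, l2GnsMap_sub, heq, sub_self, inner_zero_left]
  · ext i
    change _ = (T z).1 i + ((S x).1 i + (-1 : ℂ) • (T z).1 i)
    module
end
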